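/- (Instability of hyperplanes, Lemma 5.1.) Let n ≥ 1 be an integer. Then there exist reals r > 0 and c > 0 such that the function u(t) = ∏_{i=1}^n cos(π t_i / r) on ℝ^n satisfies: (i) u(t) > 0 for every t in the open cube Q_r = (−r/2, r/2)^n; (ii) u(t) = 0 whenever |t_i| = r/2 for some i; and (iii) Δu(t) − (1/2)⟨t, ∇u(t)⟩ + (1/2) u(t) ≥ c · u(t) for every t ∈ Q_r. -/

import Mathlib

open Real Finset

/-- The `i`-th partial derivative of a function `f : ℝ^n → ℝ` at `t`. -/
noncomputable def pderiv' {n : ℕ} (f : (Fin n → ℝ) → ℝ) (i : Fin n) (t : Fin n → ℝ) : ℝ :=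
  deriv (fun s : ℝ => f (Function.update t i s)) (t i)

/-- The Euclidean Laplacian of `f : ℝ^n → ℝ` at `t`: the sum of the second partial
derivatives `∑ i, ∂²f/∂t_i²`. -/
noncomputable def laplacian' {n : ℕ} (f : (Fin n → ℝ) → ℝ) (t : Fin n → ℝ) : ℝ :=
  ∑ i, pderiv' (pderiv' f i) i t

/-- The function `u(t) = ∏_{i=1}^n cos(π t_i / r)` on `ℝ^n`. -/
noncomputable def uFun (n : ℕ) (r : ℝ) (t : Fin n → ℝ) : ℝ :=
  ∏ i, Real.cos (π * t i / r)

theorem uFun_eq_cos_mul_prod_erase {n : ℕ} (r : ℝ) (i : Fin n) (t : Fin n → ℝ) :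
    uFun n r t = cos (π * t i / r) * ∏ j ∈ univ.erase i, cos (π * t j / r) :=
  (mul_prod_erase univ (fun j => cos (π * t j / r)) (mem_univ i)).symm

theorem prod_erase_update {n : ℕ} (g : ℝ → ℝ) (i : Fin n) (t : Fin n → ℝ) (s : ℝ) :
    ∏ j ∈ univ.erase i, g (Function.update t i s j) = ∏ j ∈ univ.erase i, g (t j) :=
  prod_congr rfl fun j hj => by rw [Function.update_of_ne (ne_of_mem_erase hj)]

theorem hasDerivAt_mul_div (a r x : ℝ) : HasDerivAt (fun s : ℝ => a * s / r) (a / r) x := by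
  simpa using ((hasDerivAt_id x).const_mul a).div_const r

theorem pderiv_uFun {n : ℕ} (r : ℝ) (i : Fin n) (t : Fin n → ℝ) :
    pderiv' (uFun n r) i t =
      -sin (π * t i / r) * (π / r) * ∏ j ∈ univ.erase i, cos (π * t j / r) := by
  have h (s : ℝ) : uFun n r (Function.update t i s) =
      cos (π * s / r) * ∏ j ∈ univ.erase i, cos (π * t j / r) := by
    rw [uFun_eq_cos_mul_prod_erase r i, Function.update_self,
      prod_erase_update (fun x => cos (π * x / r))]
  simp only [pderiv', h]
  exact ((hasDerivAt_mul_div π r (t i)).cos.mul_const _).deriv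

theorem pderiv_pderiv_uFun {n : ℕ} (r : ℝ) (i : Fin n) (t : Fin n → ℝ) :
    pderiv' (pderiv' (uFun n r) i) i t = -(π / r) ^ 2 * uFun n r t := by
  have h (s : ℝ) : pderiv' (uFun n r) i (Function.update t i s) =
      -sin (π * s / r) * (π / r) * ∏ j ∈ univ.erase i, cos (π * t j / r) := by
    rw [pderiv_uFun, Function.update_self, prod_erase_update (fun x => cos (π * x / r))]
  rw [pderiv']
  simp only [h]
  rw [(((hasDerivAt_mul_div π r (t i)).sin.fun_neg.mul_const _).mul_const _).deriv,
    uFun_eq_cos_mul_prod_erase r i]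
  ring

theorem laplacian_uFun {n : ℕ} (r : ℝ) (t : Fin n → ℝ) :
    laplacian' (uFun n r) t = -(n * (π / r) ^ 2) * uFun n r t := by
  simp only [laplacian', pderiv_pderiv_uFun, sum_const, card_univ, Fintype.card_fin, nsmul_eq_mul]
  ring

theorem pi_mul_div_mem_Ioo {r x : ℝ} (hr : 0 < r) (hx : x ∈ Set.Ioo (-(r / 2)) (r / 2)) :
    π * x / r ∈ Set.Ioo (-(π / 2)) (π / 2) := by
  constructor
  · rw [lt_div_iff₀ hr]
    nlinarith [pi_pos, hx.1]
  · rw [div_lt_iff₀ hr]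
    nlinarith [pi_pos, hx.2]

theorem mul_sin_nonneg {x : ℝ} (hx : x ∈ Set.Ioo (-(π / 2)) (π / 2)) : 0 ≤ x * sin x := by
  rcases le_total 0 x with h | h
  · exact mul_nonneg h (sin_nonneg_of_nonneg_of_le_pi h (by linarith [hx.2, pi_pos]))
  · exact mul_nonneg_of_nonpos_of_nonpos h
      (sin_nonpos_of_nonpos_of_neg_pi_le h (by linarith [hx.1, pi_pos]))

theorem uFun_pos {n : ℕ} {r : ℝ} (hr : 0 < r) {t : Fin n → ℝ}
    (ht : ∀ i, t i ∈ Set.Ioo (-(r / 2)) (r / 2)) : 0 < uFun n r t :=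
  prod_pos fun i _ => cos_pos_of_mem_Ioo (pi_mul_div_mem_Ioo hr (ht i))

theorem uFun_eq_zero {n : ℕ} {r : ℝ} (hr : 0 < r) {t : Fin n → ℝ} {i : Fin n}
    (hi : |t i| = r / 2) : uFun n r t = 0 := by
  refine prod_eq_zero (mem_univ i) ?_
  have h : |π * t i / r| = π / 2 := by
    rw [abs_div, abs_mul, abs_of_pos pi_pos, abs_of_pos hr, hi]
    field_simp
  rw [← cos_abs, h, cos_pi_div_two]

theorem mul_pderiv_uFun_nonpos {n : ℕ} {r : ℝ} (hr : 0 < r) {t : Fin n → ℝ}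
    (ht : ∀ i, t i ∈ Set.Ioo (-(r / 2)) (r / 2)) (i : Fin n) :
    t i * pderiv' (uFun n r) i t ≤ 0 := by
  have hprod : 0 ≤ ∏ j ∈ univ.erase i, cos (π * t j / r) :=
    prod_nonneg fun j _ => (cos_pos_of_mem_Ioo (pi_mul_div_mem_Ioo hr (ht j))).le
  have h := mul_nonneg (mul_sin_nonneg (pi_mul_div_mem_Ioo hr (ht i))) hprod
  rw [pderiv_uFun]
  calc _ = -(π * t i / r * sin (π * t i / r) * ∏ j ∈ univ.erase i, cos (π * t j / r)) := by ring
    _ ≤ 0 := neg_nonpos.2 h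

/-- (Instability of hyperplanes, Lemma 5.1.) Let `n ≥ 1` be an integer. Then there exist
reals `r > 0` and `c > 0` such that the function `u(t) = ∏_{i=1}^n cos(π t_i / r)` on `ℝ^n`
satisfies:
(i) `u(t) > 0` for every `t` in the open cube `Q_r = (−r/2, r/2)^n`;
(ii) `u(t) = 0` whenever `|t_i| = r/2` for some `i`; and
(iii) `Δu(t) − (1/2)⟨t, ∇u(t)⟩ + (1/2) u(t) ≥ c · u(t)` for every `t ∈ Q_r`. -/
theorem hyperplane_unstable (n : ℕ) (hn : 1 ≤ n) :
    ∃ r c : ℝ, 0 < r ∧ 0 < c ∧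
      (∀ t : Fin n → ℝ, (∀ i, t i ∈ Set.Ioo (-(r / 2)) (r / 2)) → 0 < uFun n r t) ∧
      (∀ t : Fin n → ℝ, (∃ i, |t i| = r / 2) → uFun n r t = 0) ∧
      (∀ t : Fin n → ℝ, (∀ i, t i ∈ Set.Ioo (-(r / 2)) (r / 2)) →
        laplacian' (uFun n r) t - (1 / 2) * (∑ i, t i * pderiv' (uFun n r) i t)
            + (1 / 2) * uFun n r t
          ≥ c * uFun n r t) := by
  have hn' : (1 : ℝ) ≤ n := by exact_mod_cast hn
  have hr : 0 < 2 * π * n := by positivity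
  refine ⟨2 * π * n, 1 / 4, hr, by norm_num, fun t ht => uFun_pos hr ht,
    fun t ⟨i, hi⟩ => uFun_eq_zero hr hi, fun t ht => ?_⟩
  have hu := uFun_pos hr ht
  have hsum : ∑ i, t i * pderiv' (uFun n (2 * π * n)) i t ≤ 0 :=
    sum_nonpos fun i _ => mul_pderiv_uFun_nonpos hr ht i
  have hcoef : n * (π / (2 * π * n)) ^ 2 ≤ 1 / 4 := by
    have h : n * (π / (2 * π * n)) ^ 2 = 1 / (4 * (n : ℝ)) := by
      field_simp
      norm_num
    rw [h]
    exact one_div_le_one_div_of_le (by norm_num) (by linarith)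
  rw [laplacian_uFun]
  nlinarith [mul_le_mul_of_nonneg_right hcoef hu.le]
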